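/- The image of ℤ[√2] under the star map x = u+v√2 ↦ x* = u-v√2 restricted to any cut-and-project set is such that the set Λ = {x ∈ ℤ[√2] : x* ∈ W} has no nonzero period whenever W is a bounded subset of ℝ with nonempty interior: if t ∈ ℝ satisfies Λ + t = Λ and Λ is nonempty, then t = 0. -/

import Mathlib

/-- `1` and `√2` are linearly independent over `ℤ`. -/
theorem int_add_int_mul_sqrt_two_eq_zero {a b : ℤ}
    (h : (a : ℝ) + (b : ℝ) * Real.sqrt 2 = 0) : a = 0 ∧ b = 0 := by
  have hb : b = 0 := by
    by_contra hb
    exact ((irrational_sqrt_two.intCast_mul hb).intCast_add a).ne_zero h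
  subst hb
  exact ⟨by simpa using h, rfl⟩

/-- If an arithmetic progression `c + n * d` stays in a bounded set, its difference `d` is zero. -/
theorem Bornology.IsBounded.eq_zero_of_forall_add_nat_mul_mem {W : Set ℝ}
    (hW : Bornology.IsBounded W) {c d : ℝ} (h : ∀ n : ℕ, c + n * d ∈ W) : d = 0 := by
  obtain ⟨C, hC⟩ := hW.exists_norm_le
  by_contra hd
  have hd' : 0 < |d| := abs_pos.mpr hd
  obtain ⟨n, hn⟩ := exists_nat_gt ((C + |c|) / |d|)
  rw [div_lt_iff₀ hd'] at hn
  have h1 : |c + n * d| ≤ C := hC _ (h n)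
  have h2 : |(n : ℝ) * d| ≤ |c + n * d| + |c| := by
    simpa using abs_sub (c + n * d) c
  rw [abs_mul, Nat.abs_cast] at h2
  linarith

/-- A nonempty cut-and-project set `Λ = {u + v√2 : u - v√2 ∈ W}` with bounded window
`W` of nonempty interior has no nonzero period. -/
theorem cut_and_project_aperiodic (W : Set ℝ) (hWb : Bornology.IsBounded W)
    (hWi : (interior W).Nonempty) (t : ℝ)
    (Λ : Set ℝ)
    (hΛ : Λ = {x : ℝ | ∃ u v : ℤ,
      x = (u : ℝ) + (v : ℝ) * Real.sqrt 2 ∧ (u : ℝ) - (v : ℝ) * Real.sqrt 2 ∈ W})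
    (hne : Λ.Nonempty) (hper : (fun x => x + t) '' Λ = Λ) : t = 0 := by
  have add_mem : ∀ x ∈ Λ, x + t ∈ Λ := fun x hx => hper ▸ Set.mem_image_of_mem _ hx
  obtain ⟨x, hx⟩ := hne
  have orbit : ∀ n : ℕ, x + n * t ∈ Λ := by
    intro n
    induction n with
    | zero => simpa using hx
    | succ n ih =>
      have := add_mem _ ih
      push_cast
      convert this using 1
      ring
  have hxt := add_mem x hx
  rw [hΛ] at hx hxt orbit
  obtain ⟨u, v, hxuv, -⟩ := hx
  obtain ⟨u', v', hxt, -⟩ := hxt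
  have ht : t = ((u' - u : ℤ) : ℝ) + ((v' - v : ℤ) : ℝ) * Real.sqrt 2 := by
    push_cast
    linarith
  have star_mem : ∀ n : ℕ, ((u : ℝ) - v * Real.sqrt 2) +
      n * (((u' - u : ℤ) : ℝ) - ((v' - v : ℤ) : ℝ) * Real.sqrt 2) ∈ W := by
    intro n
    obtain ⟨p, q, hpq, hW⟩ := orbit n
    obtain ⟨hp, hq⟩ := int_add_int_mul_sqrt_two_eq_zero
      (a := u + n * (u' - u) - p) (b := v + n * (v' - v) - q) (by
        rw [hxuv, ht] at hpq
        push_cast at hpq ⊢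
        linarith)
    obtain rfl : p = u + n * (u' - u) := by linarith
    obtain rfl : q = v + n * (v' - v) := by linarith
    convert hW using 1
    push_cast
    ring
  have hstar := hWb.eq_zero_of_forall_add_nat_mul_mem star_mem
  obtain ⟨ha, hb⟩ := int_add_int_mul_sqrt_two_eq_zero
    (a := u' - u) (b := -(v' - v)) (by
      push_cast at hstar ⊢
      linarith)
  rw [ht, ha, neg_eq_zero.mp hb]
  simp
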